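/- arXiv:2604.22630 — 3 statements merged into one kernel-verified Lean document; each statement's English description precedes it below -/
import Mathlib

section
/- For every integer t ≥ 3 and every ε > 0, there exists n₀ such that for all n ≥ n₀, the maximum running time of the K_t-bootstrap percolation process over all starting graphs on n vertices satisfies M_{K_t}(n) ≤ ((t-3)/(t-2) + ε)·C(n,2). -/
open Finset Filter

/-- Adding `e` to the graph `H` creates a new copy of `F`, i.e. a copy using `e`. -/
def GCreates {α β : Type*} (F : SimpleGraph α) (H : SimpleGraph β) (e : Sym2 β) : Prop :=
  ∃ f : α ↪ β, (∀ a b, F.Adj a b → (H ⊔ SimpleGraph.fromEdgeSet {e}).Adj (f a) (f b)) ∧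
    ∃ a b, F.Adj a b ∧ s(f a, f b) = e

/-- One step of the `F`-bootstrap percolation process for graphs. -/
def gBootStep {α β : Type*} (F : SimpleGraph α) (H : SimpleGraph β) : SimpleGraph β :=
  H ⊔ SimpleGraph.fromEdgeSet {e | GCreates F H e}

/-- The `F`-bootstrap percolation process starting with `H0`. -/
def gProcSeq {α β : Type*} (F : SimpleGraph α) (H0 : SimpleGraph β) : ℕ → SimpleGraph β
  | 0 => H0
  | i + 1 => gBootStep F (gProcSeq F H0 i)

/-- The running time `τ_F(H0)` of the `F`-process starting with `H0`. -/
noncomputable def gRunTime {α β : Type*} (F : SimpleGraph α) (H0 : SimpleGraph β) : ℕ :=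
  sInf {i | gProcSeq F H0 i = gProcSeq F H0 (i + 1)}

/-- `M_F(n)`: the maximum running time over all starting graphs on `n` vertices. -/
noncomputable def gMaxRunTime {α : Type*} (F : SimpleGraph α) (n : ℕ) : ℕ :=
  sSup {t | ∃ H0 : SimpleGraph (Fin n), t = gRunTime F H0}

/-- `H` contains a copy of `F` (as a subgraph). -/
def GContains {α β : Type*} (F : SimpleGraph α) (H : SimpleGraph β) : Prop :=
  ∃ f : α ↪ β, ∀ a b, F.Adj a b → H.Adj (f a) (f b)

/-- The Turán extremal number `ex(n, F)` for graphs. -/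
noncomputable def gExNum {α : Type*} (F : SimpleGraph α) (n : ℕ) : ℕ :=
  sSup {m | ∃ H : SimpleGraph (Fin n), ¬ GContains F H ∧ m = H.edgeSet.ncard}


open SimpleGraph in
/-- Adding to `H` an edge whose endpoints are joined to a clique of size `t - 2`. -/
theorem bootStep_adj_of_clique {β : Type*} [DecidableEq β] {t : ℕ} (H : SimpleGraph β)
    {u v : β} (huv : u ≠ v) (S : Finset β) (hS : S.card + 2 = t)
    (hclique : ∀ x ∈ S, ∀ y ∈ S, x ≠ y → H.Adj x y)
    (hu : ∀ x ∈ S, H.Adj u x) (hv : ∀ x ∈ S, H.Adj v x) :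
    (gBootStep (⊤ : SimpleGraph (Fin t)) H).Adj u v := by
  have hvS : v ∉ S := fun h => H.irrefl (hv v h)
  have huS : u ∉ insert v S := by
    simp only [Finset.mem_insert, not_or]
    exact ⟨huv, fun h => H.irrefl (hu u h)⟩
  have hcard : (insert u (insert v S)).card = t := by
    rw [Finset.card_insert_of_notMem huS, Finset.card_insert_of_notMem hvS, ← hS]
  let e := Finset.equivFinOfCardEq hcard
  have hadj : ∀ x ∈ insert u (insert v S), ∀ y ∈ insert u (insert v S), x ≠ y →
      (H ⊔ SimpleGraph.fromEdgeSet {s(u, v)}).Adj x y := by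
    intro x hx y hy hxy
    simp only [Finset.mem_insert] at hx hy
    simp only [sup_adj, fromEdgeSet_adj, Set.mem_singleton_iff, ne_eq]
    rcases hx with rfl | rfl | hx <;> rcases hy with rfl | rfl | hy
    · exact absurd rfl hxy
    · exact Or.inr ⟨rfl, hxy⟩
    · exact Or.inl (hu _ hy)
    · exact Or.inr ⟨Sym2.eq_swap, hxy⟩
    · exact absurd rfl hxy
    · exact Or.inl (hv _ hy)
    · exact Or.inl (hu _ hx).symm
    · exact Or.inl (hv _ hx).symm
    · exact Or.inl (hclique _ hx _ hy hxy)
  have hcr : GCreates (⊤ : SimpleGraph (Fin t)) H s(u, v) := by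
    refine ⟨e.symm.toEmbedding.trans (Function.Embedding.subtype _), ?_, ?_⟩
    · intro a b hab
      refine hadj _ (e.symm a).2 _ (e.symm b).2 ?_
      intro h
      exact hab (e.symm.injective (Subtype.ext h))
    · refine ⟨e ⟨u, by simp⟩, e ⟨v, by simp⟩, ?_, ?_⟩
      · rw [top_adj]
        intro h
        exact huv (congrArg Subtype.val (e.injective h))
      · simp
  unfold gBootStep
  rw [sup_adj, fromEdgeSet_adj]
  exact Or.inr ⟨hcr, huv⟩

theorem le_gBootStep {α β : Type*} (F : SimpleGraph α) (H : SimpleGraph β) :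
    H ≤ gBootStep F H := le_sup_left

theorem gProcSeq_mono {α β : Type*} (F : SimpleGraph α) (H : SimpleGraph β) :
    Monotone (gProcSeq F H) :=
  monotone_nat_of_le_succ fun i => le_gBootStep F (gProcSeq F H i)

/-- A complete equipartite graph with parts of size `4` and at most `3` missing edges is filled
in within two steps. -/
theorem two_steps {β : Type*} [DecidableEq β] {r : ℕ} (H : SimpleGraph β)
    (φ : Fin r × Fin 4 ↪ β) (D : Finset (Sym2 β)) (hD : D.card ≤ 3)
    (hH : ∀ x y : Fin r × Fin 4, x.1 ≠ y.1 → s(φ x, φ y) ∉ D → H.Adj (φ x) (φ y))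
    (x y : Fin r × Fin 4) (hxy : x.1 ≠ y.1) :
    (gBootStep (⊤ : SimpleGraph (Fin (r + 1)))
      (gBootStep (⊤ : SimpleGraph (Fin (r + 1))) H)).Adj (φ x) (φ y) := by
  have hgood : ∀ i : Fin r, ∃ k : Fin 4, ∀ z : Fin r × Fin 4, i ≠ z.1 →
      H.Adj (φ (i, k)) (φ z) := by
    intro i
    by_contra! hcon
    choose z hz hnot using hcon
    have hmem : ∀ k, s(φ (i, k), φ (z k)) ∈ D := by
      intro k
      by_contra h
      exact hnot k (hH _ _ (hz k) h)
    have hinj : Function.Injective fun k => s(φ (i, k), φ (z k)) := by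
      intro k l hkl
      simp only [Sym2.eq_iff, φ.injective.eq_iff] at hkl
      rcases hkl with ⟨h, _⟩ | ⟨h, _⟩
      · exact (Prod.mk.inj h).2
      · exact absurd (congrArg Prod.fst h) (hz l)
    have := Finset.card_le_card_of_injOn (s := Finset.univ) (t := D) _
      (fun k _ => hmem k) hinj.injOn
    simp at this
    omega
  choose w hw using hgood
  let S : Fin r → Finset β := fun j => (Finset.univ.erase j).image fun l => φ (l, w l)
  have hScard : ∀ j, (S j).card + 2 = r + 1 := by
    intro j
    have : (S j).card = r - 1 := by
      rw [Finset.card_image_of_injective, Finset.card_erase_of_mem (Finset.mem_univ _)]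
      · simp
      · intro a b hab
        exact (Prod.mk.inj (φ.injective hab)).1
    have := j.pos
    omega
  have hScl : ∀ j, ∀ a ∈ S j, ∀ b ∈ S j, a ≠ b → H.Adj a b := by
    intro j a ha b hb hab
    simp only [S, Finset.mem_image] at ha hb
    obtain ⟨k, _, rfl⟩ := ha
    obtain ⟨l, _, rfl⟩ := hb
    refine hw k (l, w l) ?_
    rintro rfl
    exact hab rfl
  have hout : ∀ j k, ∀ a ∈ S j, H.Adj (φ (j, k)) a := by
    intro j k a ha
    simp only [S, Finset.mem_image, Finset.mem_erase] at ha
    obtain ⟨l, ⟨hl, _⟩, rfl⟩ := ha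
    exact (hw l (j, k) hl).symm
  have hstep1 : ∀ i k, k ≠ w i →
      (gBootStep (⊤ : SimpleGraph (Fin (r + 1))) H).Adj (φ (i, k)) (φ (i, w i)) := by
    intro i k hk
    refine bootStep_adj_of_clique H ?_ (S i) (hScard i) (hScl i) (hout i k) (hout i (w i))
    intro h
    exact hk (Prod.mk.inj (φ.injective h)).2
  obtain ⟨i, a⟩ := x
  obtain ⟨j, b⟩ := y
  by_cases ha : a = w i
  · subst ha
    exact le_gBootStep _ _ (le_gBootStep _ _ (hw i (j, b) hxy))
  refine bootStep_adj_of_clique _ ?_ (S j) (hScard j) ?_ ?_ ?_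
  · intro h
    exact hxy (congrArg Prod.fst (φ.injective h))
  · intro c hc d hd hcd
    exact le_gBootStep _ _ (hScl j c hc d hd hcd)
  · intro c hc
    simp only [S, Finset.mem_image, Finset.mem_erase] at hc
    obtain ⟨l, ⟨hl, _⟩, rfl⟩ := hc
    by_cases hli : l = i
    · subst hli
      exact hstep1 _ _ ha
    · exact le_gBootStep _ _ (hw l (i, a) hli).symm
  · intro c hc
    exact le_gBootStep _ _ (hout j b c hc)

open SimpleGraph in
/-- The running time of the `K_{r+1}`-process is at most `ex(n, K_r(4))`. -/
theorem gRunTime_le_extremal {n r : ℕ} (hr : 2 ≤ r) (H0 : SimpleGraph (Fin n)) :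
    gRunTime (⊤ : SimpleGraph (Fin (r + 1))) H0 ≤
      extremalNumber n (completeEquipartiteGraph r 4) := by
  classical
  set F := (⊤ : SimpleGraph (Fin (r + 1))) with hF
  set τ := gRunTime F H0 with hτ
  have hmono := gProcSeq_mono F H0
  have hne : ∀ i, i < τ → ∃ e, e ∈ (gProcSeq F H0 (i + 1)).edgeSet ∧
      e ∉ (gProcSeq F H0 i).edgeSet := by
    intro i hi
    by_contra! hcon
    have heq : gProcSeq F H0 i = gProcSeq F H0 (i + 1) :=
      le_antisymm (hmono (Nat.le_succ i)) (edgeSet_subset_edgeSet.1 hcon)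
    exact Nat.notMem_of_lt_sInf hi heq
  rcases Nat.eq_zero_or_pos τ with h0 | hpos
  · rw [h0]
    exact Nat.zero_le _
  have : Nonempty (Sym2 (Fin n)) := ⟨(hne 0 hpos).choose⟩
  choose! e he1 he2 using hne
  have hlt : ∀ i j, j < τ → i < j → e i ∈ (gProcSeq F H0 j).edgeSet := by
    intro i j hj hij
    exact edgeSet_subset_edgeSet.2 (hmono hij) (he1 i (hij.trans hj))
  have hinj : Set.InjOn e (Finset.range τ : Set ℕ) := by
    intro i hi j hj hij
    simp only [Finset.coe_range, Set.mem_Iio] at hi hj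
    rcases lt_trichotomy i j with h | h | h
    · exact absurd (hij ▸ hlt i j hj h) (he2 j hj)
    · exact h
    · exact absurd (hij ▸ hlt j i hi h) (he2 i hi)
  let E : Finset (Sym2 (Fin n)) := (Finset.range τ).image e
  have hEcard : E.card = τ := by
    rw [Finset.card_image_of_injOn hinj, Finset.card_range]
  let G : SimpleGraph (Fin n) := fromEdgeSet (E : Set (Sym2 (Fin n)))
  have hGE : G.edgeFinset = E := by
    ext x
    simp only [G, mem_edgeFinset, edgeSet_fromEdgeSet, Set.mem_sdiff, Finset.mem_coe]
    refine ⟨fun h => h.1, fun h => ⟨h, ?_⟩⟩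
    obtain ⟨i, hi, rfl⟩ := Finset.mem_image.1 h
    exact not_isDiag_of_mem_edgeSet _ (he1 i (Finset.mem_range.1 hi))
  have hfree : (completeEquipartiteGraph r 4).Free G := by
    rintro ⟨φ⟩
    have hφinj : Function.Injective φ := φ.injective
    have hφadj : ∀ x y : Fin r × Fin 4, x.1 ≠ y.1 → s(φ x, φ y) ∈ E := by
      intro x y hxy
      have : G.Adj (φ x) (φ y) := φ.toHom.map_adj (completeEquipartiteGraph_adj.2 hxy)
      rw [← hGE]
      simpa using this
    let T : Finset ℕ := (Finset.range τ).filter fun i => ∃ x y : Fin r × Fin 4,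
      x.1 ≠ y.1 ∧ s(φ x, φ y) = e i
    have hT : ∀ x y : Fin r × Fin 4, x.1 ≠ y.1 → ∃ i ∈ T, e i = s(φ x, φ y) := by
      intro x y hxy
      obtain ⟨i, hi, hie⟩ := Finset.mem_image.1 (hφadj x y hxy)
      exact ⟨i, Finset.mem_filter.2 ⟨hi, x, y, hxy, hie.symm⟩, hie⟩
    have hTτ : ∀ i ∈ T, i < τ := fun i hi => Finset.mem_range.1 (Finset.mem_filter.1 hi).1
    have hTcard : 4 ≤ T.card := by
      let i0 : Fin r := ⟨0, by omega⟩
      let i1 : Fin r := ⟨1, by omega⟩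
      have h01 : i0 ≠ i1 := by simp [i0, i1]
      choose g hg hge using fun k : Fin 4 => hT (i0, 0) (i1, k) h01
      have hgi : Function.Injective g := by
        intro k l hkl
        have h := hge k
        rw [hkl, hge l] at h
        simp only [Sym2.eq_iff, hφinj.eq_iff] at h
        rcases h with ⟨_, h⟩ | ⟨h, _⟩
        · exact ((Prod.mk.inj h).2).symm
        · exact absurd (Prod.mk.inj h).1 h01
      have := Finset.card_le_card_of_injOn (s := Finset.univ) (t := T) g
        (fun k _ => hg k) hgi.injOn
      simpa using this
    have hT0 : T.Nonempty := Finset.card_pos.1 (by omega)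
    obtain ⟨a1, ha1, hm1⟩ := T.exists_max_image id hT0
    have hc1 := Finset.card_erase_of_mem ha1
    obtain ⟨a2, ha2, hm2⟩ := (T.erase a1).exists_max_image id (Finset.card_pos.1 (by omega))
    have hc2 := Finset.card_erase_of_mem ha2
    obtain ⟨a3, ha3, hm3⟩ :=
      ((T.erase a1).erase a2).exists_max_image id (Finset.card_pos.1 (by omega))
    simp only [id, Finset.mem_erase] at *
    have h21 : a2 < a1 := lt_of_le_of_ne (hm1 a2 ha2.2) ha2.1
    have h32 : a3 < a2 := lt_of_le_of_ne (hm2 a3 ha3.2) ha3.1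
    obtain ⟨x, y, hxy, hxye⟩ := (Finset.mem_filter.1 ha1).2
    have key := two_steps (gProcSeq F H0 a3) ⟨φ, hφinj⟩ {e a1, e a2, e a3}
      Finset.card_le_three (by
        intro x y hxy hD
        obtain ⟨i, hi, hie⟩ := hT x y hxy
        simp only [Function.Embedding.coeFn_mk] at hD ⊢
        rw [← hie] at hD
        simp only [Finset.mem_insert, Finset.mem_singleton, not_or] at hD
        have hi3 : i < a3 := by
          have n1 : i ≠ a1 := fun h => hD.1 (by rw [h])
          have n2 : i ≠ a2 := fun h => hD.2.1 (by rw [h])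
          have n3 : i ≠ a3 := fun h => hD.2.2 (by rw [h])
          exact lt_of_le_of_ne (hm3 i ⟨n2, n1, hi⟩) n3
        have := hlt i a3 (hTτ a3 ha3.2.2) hi3
        rw [hie] at this
        exact this) x y hxy
    have key2 : (gProcSeq F H0 (a3 + 2)).Adj (φ x) (φ y) := key
    have key3 : (gProcSeq F H0 a1).Adj (φ x) (φ y) := hmono (by omega : a3 + 2 ≤ a1) key2
    apply he2 a1 (hTτ a1 ha1)
    rw [← hxye]
    exact key3
  have hle := card_edgeFinset_le_extremalNumber hfree
  rw [Fintype.card_fin] at hle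
  have hcardG : G.edgeFinset.card = τ := by rw [hGE, hEcard]
  rw [← hcardG]
  convert hle

open SimpleGraph in
/-- Growth of the extremal number for complete equipartite graphs. -/
theorem extremal_growth {ε : ℝ} (hε : 0 < ε) {r : ℕ} (hr : 1 ≤ r) :
    ∃ N : ℕ, ∀ n, N ≤ n →
      (extremalNumber (n + 1) (completeEquipartiteGraph (r + 1) 4) : ℝ) ≤
        extremalNumber n (completeEquipartiteGraph (r + 1) 4) +
          (1 - 1 / (r : ℝ) + ε) * ((n : ℝ) + 1) := by
  classical
  obtain ⟨N, hN⟩ := eventually_atTop.1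
    (eventually_completeEquipartiteGraph_isContained_of_minDegree hε r 4)
  refine ⟨N, fun n hn => ?_⟩
  have hr' : (1 : ℝ) / r ≤ 1 := by
    rw [div_le_one (by positivity)]
    exact_mod_cast hr
  have hc : 0 ≤ 1 - 1 / (r : ℝ) + ε := by linarith
  have key := (extremalNumber_le_iff_of_nonneg (V := Fin (n + 1)) (R := ℝ)
    (completeEquipartiteGraph (r + 1) 4)
    (m := extremalNumber n (completeEquipartiteGraph (r + 1) 4) +
          (1 - 1 / (r : ℝ) + ε) * ((n : ℝ) + 1)) (by positivity)).2
  rw [Fintype.card_fin] at key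
  apply key
  intro G _ hG
  have hdeg : (G.minDegree : ℝ) < (1 - 1 / (r : ℝ) + ε) * ((n + 1 : ℕ) : ℝ) := by
    by_contra! h
    exact hG (hN (n + 1) (by omega) h)
  obtain ⟨v, hv⟩ := G.exists_minimal_degree_vertex
  have h1 := card_edgeFinset_deleteIncidenceSet_le_extremalNumber hG v
  rw [card_edgeFinset_deleteIncidenceSet, Fintype.card_fin, Nat.add_sub_cancel, ← hv] at h1
  have h2 : G.edgeFinset.card ≤
      extremalNumber n (completeEquipartiteGraph (r + 1) 4) + G.minDegree := by omega
  have h3 : (G.edgeFinset.card : ℝ) ≤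
      extremalNumber n (completeEquipartiteGraph (r + 1) 4) + G.minDegree := by exact_mod_cast h2
  push_cast at hdeg
  linarith

/-- A sequence growing by at most `c * (n + 1)` is eventually at most `(c + ε) * C(n, 2)`. -/
theorem growth_bound (f : ℕ → ℝ) (c ε : ℝ) (hc : 0 ≤ c) (hε : 0 < ε) (N : ℕ)
    (hf : ∀ n, N ≤ n → f (n + 1) ≤ f n + c * ((n : ℝ) + 1)) :
    ∃ n₀ : ℕ, ∀ n, n₀ ≤ n → f n ≤ (c + ε) * (n.choose 2 : ℝ) := by
  have hind : ∀ n, N ≤ n → f n ≤ |f N| + c * ((n : ℝ) * (n + 1) / 2) := by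
    intro n hn
    induction n, hn using Nat.le_induction with
    | base =>
      have := le_abs_self (f N)
      have : 0 ≤ c * ((N : ℝ) * (N + 1) / 2) := by positivity
      linarith
    | succ n hn ih =>
      have := hf n hn
      push_cast
      nlinarith
  obtain ⟨M, hM⟩ := exists_nat_ge (2 * (|f N| + c) / ε)
  refine ⟨max N (M + 2), fun n hn => ?_⟩
  have h1 := hind n (le_trans (le_max_left _ _) hn)
  have h2 : ((M + 2 : ℕ) : ℝ) ≤ n := by exact_mod_cast le_trans (le_max_right _ _) hn
  push_cast at h2
  rw [div_le_iff₀ hε] at hM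
  rw [Nat.cast_choose_two]
  have h0 := abs_nonneg (f N)
  have h3 : (2 * (|f N| + c)) * n ≤ (ε * (n - 1)) * n := by
    apply mul_le_mul_of_nonneg_right _ (by positivity)
    nlinarith
  have h4 : |f N| * 1 ≤ |f N| * n := by
    apply mul_le_mul_of_nonneg_left _ h0
    have : (0 : ℝ) ≤ M := by positivity
    linarith
  nlinarith

/-- For every `t ≥ 3` and `ε > 0`, for all sufficiently large `n`,
`M_{K_t}(n) ≤ ((t-3)/(t-2) + ε) · C(n,2)`. -/
theorem maxRunTime_clique_le (t : ℕ) (ht : 3 ≤ t) (ε : ℝ) (hε : 0 < ε) :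
    ∃ n₀ : ℕ, ∀ n : ℕ, n₀ ≤ n →
      (gMaxRunTime (⊤ : SimpleGraph (Fin t)) n : ℝ) ≤
        (((t : ℝ) - 3) / ((t : ℝ) - 2) + ε) * (n.choose 2 : ℝ) := by
  obtain ⟨s, rfl⟩ : ∃ s, t = s + 3 := ⟨t - 3, by omega⟩
  have hε2 : 0 < ε / 2 := by positivity
  obtain ⟨N, hN⟩ := extremal_growth hε2 (r := s + 1) (by omega)
  have hrr : (1 : ℝ) - 1 / ((s + 1 : ℕ) : ℝ) = (((s + 3 : ℕ) : ℝ) - 3) / (((s + 3 : ℕ) : ℝ) - 2) := by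
    push_cast
    have : (s : ℝ) + 1 ≠ 0 := by positivity
    have h2 : (s : ℝ) + 3 - 2 ≠ 0 := by
      intro h
      apply this
      linarith
    field_simp
    ring
  have hc : (0 : ℝ) ≤ 1 - 1 / ((s + 1 : ℕ) : ℝ) + ε / 2 := by
    have : (1 : ℝ) / ((s + 1 : ℕ) : ℝ) ≤ 1 := by
      rw [div_le_one (by positivity)]
      push_cast
      linarith [(Nat.cast_nonneg s : (0 : ℝ) ≤ s)]
    linarith
  obtain ⟨n₀, hn₀⟩ := growth_bound
    (fun n => (SimpleGraph.extremalNumber n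
      (SimpleGraph.completeEquipartiteGraph (s + 1 + 1) 4) : ℝ)) _ (ε / 2) hc hε2 N hN
  refine ⟨n₀, fun n hn => ?_⟩
  have hb := hn₀ n hn
  rw [hrr, add_assoc (_ / _ : ℝ), add_halves] at hb
  refine le_trans ?_ hb
  have hmax : gMaxRunTime (⊤ : SimpleGraph (Fin (s + 3))) n ≤
      SimpleGraph.extremalNumber n (SimpleGraph.completeEquipartiteGraph (s + 1 + 1) 4) := by
    unfold gMaxRunTime
    refine csSup_le ⟨_, ⊥, rfl⟩ ?_
    rintro _ ⟨H0, rfl⟩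
    exact gRunTime_le_extremal (r := s + 1 + 1) (by omega) H0
  exact_mod_cast hmax
end

section
/- For every integer k ≥ 2, every k-uniform hypergraph F, every edge e ∈ E(F), and every ε > 0, there exists n₀ such that for all n ≥ n₀ we have M_F(n) ≤ (π(F−e) + ε)·C(n,k), where π denotes the Turán density. -/
open Finset Set Filter

/-- Adding the `k`-set `e` to the hypergraph with edge set `H` creates a new copy of the
hypergraph with edge set `Fe`, i.e. a copy containing `e` as an edge. -/
def CreatesCopy {ι V : Type*} (Fe : Set (Finset ι)) (H : Set (Finset V)) (e : Finset V) : Prop :=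
  ∃ f : ι ↪ V, (∀ s ∈ Fe, s.map f ∈ H ∪ {e}) ∧ ∃ s ∈ Fe, s.map f = e

/-- One step of the `F`-bootstrap percolation process for `k`-graphs. -/
def bootStep {ι V : Type*} (k : ℕ) (Fe : Set (Finset ι)) (H : Set (Finset V)) :
    Set (Finset V) :=
  H ∪ {e | e.card = k ∧ CreatesCopy Fe H e}

/-- The `F`-bootstrap percolation process starting with `H0`. -/
def procSeq {ι V : Type*} (k : ℕ) (Fe : Set (Finset ι)) (H0 : Set (Finset V)) :
    ℕ → Set (Finset V)
  | 0 => H0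
  | i + 1 => bootStep k Fe (procSeq k Fe H0 i)

/-- The running time of the `F`-bootstrap percolation process starting with `H0`. -/
noncomputable def runTime {ι V : Type*} (k : ℕ) (Fe : Set (Finset ι))
    (H0 : Set (Finset V)) : ℕ :=
  sInf {i | procSeq k Fe H0 i = procSeq k Fe H0 (i + 1)}

/-- The maximum running time over all `k`-uniform starting hypergraphs on `n` vertices. -/
noncomputable def maxRunTime {ι : Type*} (k : ℕ) (Fe : Set (Finset ι)) (n : ℕ) : ℕ :=
  sSup {t | ∃ H0 : Set (Finset (Fin n)), (∀ e ∈ H0, e.card = k) ∧ t = runTime k Fe H0}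

/-- `H` contains a copy of the hypergraph with edge set `Fe`. -/
def ContainsCopy {ι V : Type*} (Fe : Set (Finset ι)) (H : Set (Finset V)) : Prop :=
  ∃ f : ι ↪ V, ∀ s ∈ Fe, s.map f ∈ H

/-- The Turán extremal number `ex(n, F)` for `k`-graphs. -/
noncomputable def exNum {ι : Type*} (k : ℕ) (Fe : Set (Finset ι)) (n : ℕ) : ℕ :=
  sSup {m | ∃ H : Set (Finset (Fin n)),
    (∀ e ∈ H, e.card = k) ∧ ¬ ContainsCopy Fe H ∧ m = H.ncard}

/-- The Turán density `π(F)`. -/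
noncomputable def turanDensity {ι : Type*} (k : ℕ) (Fe : Set (Finset ι)) : ℝ :=
  limUnder atTop (fun n : ℕ => (exNum k Fe n : ℝ) / (n.choose k : ℝ))

/-- The copies of `F` in `H`, as subhypergraphs: pairs of a vertex set and an edge set. -/
def copies {ι V : Type*} [Fintype ι] (Fe : Set (Finset ι)) (H : Set (Finset V)) :
    Set (Finset V × Set (Finset V)) :=
  {p | ∃ f : ι ↪ V, p.1 = Finset.univ.map f ∧ p.2 = (fun s => s.map f) '' Fe ∧
    ∀ s ∈ Fe, s.map f ∈ H}

/-- The step of the process at which the edge `e` is added (`0` if `e ∈ H0`). -/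
noncomputable def stepOf {ι V : Type*} (k : ℕ) (Fe : Set (Finset ι)) (H0 : Set (Finset V))
    (e : Finset V) : ℕ :=
  sInf {s | e ∈ procSeq k Fe H0 s}

/-- `i(D)`: the largest step index whose chosen edge belongs to the edge set `Ed`. -/
noncomputable def idxMax {V : Type*} (e : ℕ → Finset V) (τ : ℕ) (Ed : Set (Finset V)) : ℕ :=
  sSup {i | i ∈ Set.Icc 1 τ ∧ e i ∈ Ed}

/-- `j(D)`: the largest step index whose chosen edge belongs to `Ed` minus `e_{i(D)}`. -/
noncomputable def idxSnd {V : Type*} (e : ℕ → Finset V) (τ : ℕ) (Ed : Set (Finset V)) : ℕ :=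
  sSup {j | j ∈ Set.Icc 1 τ ∧ e j ∈ Ed \ {e (idxMax e τ Ed)}}

/-- The type (1–4) of a copy `D` with completing edge `eD`, as in the paper. -/
def copyType {ι V : Type*} (k : ℕ) (Fe : Set (Finset ι)) (H0 : Set (Finset V))
    (e : ℕ → Finset V) (τ : ℕ) (eD : Finset V) (Ed : Set (Finset V)) (α : ℕ) : Prop :=
  (α = 1 ∧ stepOf k Fe H0 eD ≤ idxSnd e τ Ed) ∨
  (α = 2 ∧ idxSnd e τ Ed < stepOf k Fe H0 eD ∧ stepOf k Fe H0 eD < idxMax e τ Ed) ∨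
  (α = 3 ∧ idxMax e τ Ed < stepOf k Fe H0 eD) ∨
  (α = 4 ∧ stepOf k Fe H0 eD = idxMax e τ Ed)

namespace BootAux

lemma card_le_exNum {ι : Type*} (k m n : ℕ) (Fe : Set (Finset ι))
    (G : Finset (Finset (Fin n))) (hG : ∀ g ∈ G, g.card = k) (S : Finset (Fin n))
    (hS : S.card = m)
    (hfree : ¬ ∃ f : ι ↪ Fin n, (∀ v, f v ∈ S) ∧ ∀ s ∈ Fe, s.map f ∈ G) :
    (G.filter (fun g => g ⊆ S)).card ≤ exNum k Fe m := by
  classical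
  let φ : Fin m ↪ Fin n := (S.orderEmbOfFin hS).toEmbedding
  have hφ : ∀ i, φ i ∈ S := fun i => S.orderEmbOfFin_mem hS i
  have hφ' : ∀ x ∈ S, ∃ i, φ i = x := by
    intro x hx
    have := S.range_orderEmbOfFin hS
    have hx' : x ∈ Set.range (S.orderEmbOfFin hS) := by rw [this]; exact hx
    exact hx'
  let H' : Set (Finset (Fin m)) := {x | x.map φ ∈ G}
  have h1 : (G.filter (fun g => g ⊆ S)).card ≤ H'.ncard := by
    have hsub : ((G.filter (fun g => g ⊆ S) : Finset (Finset (Fin n))) : Set (Finset (Fin n)))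
        ⊆ (fun x : Finset (Fin m) => x.map φ) '' H' := by
      intro g hg
      rw [Finset.mem_coe, Finset.mem_filter] at hg
      have hm : (Finset.univ.filter (fun i => φ i ∈ g)).map φ = g := by
        ext x
        simp only [Finset.mem_map, Finset.mem_filter, Finset.mem_univ, true_and]
        constructor
        · rintro ⟨i, hi, rfl⟩; exact hi
        · intro hx
          obtain ⟨i, rfl⟩ := hφ' x (hg.2 hx)
          exact ⟨i, hx, rfl⟩
      refine ⟨_, ?_, hm⟩
      change Finset.map φ _ ∈ G
      rw [hm]; exact hg.1
    calc (G.filter (fun g => g ⊆ S)).card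
        = ((G.filter (fun g => g ⊆ S) : Finset (Finset (Fin n))) : Set (Finset (Fin n))).ncard :=
          (Set.ncard_coe_finset _).symm
      _ ≤ ((fun x : Finset (Fin m) => x.map φ) '' H').ncard :=
          Set.ncard_le_ncard hsub (Set.toFinite _)
      _ ≤ H'.ncard := Set.ncard_image_le (Set.toFinite _)
  refine h1.trans (le_csSup ?_ ⟨H', ?_, ?_, rfl⟩)
  · refine ⟨Nat.card (Finset (Fin m)), ?_⟩
    rintro _ ⟨H, -, -, rfl⟩
    exact Set.ncard_le_card H
  · intro x hx
    have := hG _ hx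
    simpa using this
  · rintro ⟨f, hf⟩
    apply hfree
    refine ⟨f.trans φ, fun v => hφ _, fun s hs => ?_⟩
    rw [← Finset.map_map]
    exact hf s hs

lemma core {ι β : Type*} (k m n : ℕ) (hkm : k ≤ m) (Fe : Set (Finset ι))
    (G : Finset (Finset (Fin n))) (hG : ∀ g ∈ G, g.card = k)
    (P : Finset β) (b : β → Finset (Fin n))
    (hfree : ∀ S : Finset (Fin n), (∀ p ∈ P, ¬ b p ⊆ S) →
      ¬ ∃ f : ι ↪ Fin n, (∀ v, f v ∈ S) ∧ ∀ s ∈ Fe, s.map f ∈ G) :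
    G.card * (n - k).choose (m - k) ≤ n.choose m * exNum k Fe m +
      m.choose k * ∑ p ∈ P, ((powersetCard m (univ : Finset (Fin n))).filter
        (fun S => b p ⊆ S)).card := by
  classical
  have h1 : G.card * (n - k).choose (m - k) =
      ∑ S ∈ powersetCard m (univ : Finset (Fin n)), (G.filter (fun g => g ⊆ S)).card := by
    have := sum_card_bipartiteAbove_eq_sum_card_bipartiteBelow
      (s := G) (t := powersetCard m (univ : Finset (Fin n))) (fun g S => g ⊆ S)
    simp only [bipartiteAbove, bipartiteBelow] at this
    rw [← this, Finset.sum_congr rfl (g := fun _ => (n - k).choose (m - k)), Finset.sum_const,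
      smul_eq_mul]
    intro g hg
    rw [card_filter_powersetCard_subset]
    · simp [hG g hg]
    all_goals simp [hG g hg, hkm]
  have h2 : ∑ p ∈ P, ((powersetCard m (univ : Finset (Fin n))).filter
        (fun S => b p ⊆ S)).card =
      ∑ S ∈ powersetCard m (univ : Finset (Fin n)), (P.filter (fun p => b p ⊆ S)).card :=
    sum_card_bipartiteAbove_eq_sum_card_bipartiteBelow
      (s := P) (t := powersetCard m (univ : Finset (Fin n))) (fun p S => b p ⊆ S)
  have h3 : n.choose m * exNum k Fe m =
      ∑ S ∈ powersetCard m (univ : Finset (Fin n)), exNum k Fe m := by simp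
  rw [h1, h2, h3, Finset.mul_sum, ← Finset.sum_add_distrib]
  refine Finset.sum_le_sum fun S hS => ?_
  have hSm : S.card = m := (mem_powersetCard.1 hS).2
  by_cases hbad : ∀ p ∈ P, ¬ b p ⊆ S
  · exact (card_le_exNum k m n Fe G hG S hSm (hfree S hbad)).trans (Nat.le_add_right _ _)
  · push Not at hbad
    obtain ⟨p, hp, hpS⟩ := hbad
    have hpos : 1 ≤ (P.filter (fun p => b p ⊆ S)).card :=
      Finset.card_pos.2 ⟨p, Finset.mem_filter.2 ⟨hp, hpS⟩⟩
    have hle : (G.filter (fun g => g ⊆ S)).card ≤ m.choose k := by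
      rw [← hSm, ← card_powersetCard]
      apply Finset.card_le_card
      intro g hg
      rw [Finset.mem_filter] at hg
      exact mem_powersetCard.2 ⟨hg.2, hG g hg.1⟩
    nlinarith [Nat.zero_le (exNum k Fe m)]

lemma exNum_mul_le {ι : Type*} (k m n : ℕ) (hkm : k ≤ m) (Fe : Set (Finset ι)) :
    exNum k Fe n * (n - k).choose (m - k) ≤ n.choose m * exNum k Fe m := by
  classical
  rcases Set.eq_empty_or_nonempty {a | ∃ H : Set (Finset (Fin n)),
    (∀ e ∈ H, e.card = k) ∧ ¬ ContainsCopy Fe H ∧ a = H.ncard} with h | h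
  · have : exNum k Fe n = 0 := by rw [exNum, h]; simp
    simp [this]
  · have hmem := Nat.sSup_mem h (by
      refine ⟨Nat.card (Finset (Fin n)), ?_⟩
      rintro _ ⟨H, -, -, rfl⟩
      exact Set.ncard_le_card H)
    obtain ⟨H, hH, hfree, hc⟩ := hmem
    have h := core k m n hkm Fe (Set.toFinite H).toFinset (by simpa using hH)
      (∅ : Finset ℕ) (fun _ => ∅) (by
        intro S _
        rintro ⟨f, -, hf⟩
        exact hfree ⟨f, fun s hs => by simpa using hf s hs⟩)
    have hc' : exNum k Fe n = H.ncard := hc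
    rw [← Set.ncard_eq_toFinset_card, ← hc'] at h
    simpa using h

lemma ratio_anti {ι : Type*} (k m n : ℕ) (hkm : k ≤ m) (hmn : m ≤ n) (Fe : Set (Finset ι)) :
    (exNum k Fe n : ℝ) / (n.choose k : ℝ) ≤ (exNum k Fe m : ℝ) / (m.choose k : ℝ) := by
  have h := exNum_mul_le k m n hkm Fe
  have h2 := Nat.choose_mul (n := n) hkm
  have p1 : 0 < n.choose k := Nat.choose_pos (hkm.trans hmn)
  have p2 : 0 < m.choose k := Nat.choose_pos hkm
  have p3 : 0 < (n - k).choose (m - k) := Nat.choose_pos (by omega)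
  rw [div_le_div_iff₀ (by exact_mod_cast p1) (by exact_mod_cast p2)]
  norm_cast
  refine Nat.le_of_mul_le_mul_right ?_ p3
  calc exNum k Fe n * m.choose k * (n - k).choose (m - k)
      = (exNum k Fe n * (n - k).choose (m - k)) * m.choose k := by ring
    _ ≤ (n.choose m * exNum k Fe m) * m.choose k := Nat.mul_le_mul_right _ h
    _ = exNum k Fe m * (n.choose m * m.choose k) := by ring
    _ = exNum k Fe m * n.choose k * (n - k).choose (m - k) := by rw [h2]; ring

lemma exists_m {ι : Type*} (k : ℕ) (Fe : Set (Finset ι)) (ε : ℝ) (hε : 0 < ε) :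
    ∃ m, k + 1 ≤ m ∧ (exNum k Fe m : ℝ) / (m.choose k : ℝ) < turanDensity k Fe + ε := by
  have hanti : Antitone (fun n : ℕ => (exNum k Fe (n + k) : ℝ) / ((n + k).choose k : ℝ)) :=
    fun a b hab => ratio_anti k (a + k) (b + k) (by omega) (by omega) Fe
  have hb : BddBelow (Set.range
      (fun n : ℕ => (exNum k Fe (n + k) : ℝ) / ((n + k).choose k : ℝ))) := by
    refine ⟨0, ?_⟩
    rintro _ ⟨n, rfl⟩
    positivity
  have ht := tendsto_atTop_ciInf hanti hb
  rw [tendsto_add_atTop_iff_nat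
    (f := fun n : ℕ => (exNum k Fe n : ℝ) / (n.choose k : ℝ)) k] at ht
  have hl : turanDensity k Fe = _ := ht.limUnder_eq
  rw [← hl] at ht
  have h1 := ht.eventually_lt_const (show turanDensity k Fe < turanDensity k Fe + ε by linarith)
  obtain ⟨m, h, h'⟩ := (h1.and (eventually_ge_atTop (k + 1))).exists
  exact ⟨m, h', h⟩

section proc

variable {ι V : Type*} (k : ℕ) (Fe : Set (Finset ι)) (H0 : Set (Finset V))

lemma proc_mono : Monotone (procSeq k Fe H0) :=
  monotone_nat_of_le_succ fun _ => Set.subset_union_left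

lemma proc_card (h0 : ∀ e ∈ H0, e.card = k) (i : ℕ) : ∀ e ∈ procSeq k Fe H0 i, e.card = k := by
  induction i with
  | zero => exact h0
  | succ i ih =>
    rintro e (h | h)
    · exact ih e h
    · exact h.1

lemma proc_add (i : ℕ) (x : Finset V) (hx : x.card = k) (f : ι ↪ V)
    (hf : ∀ s ∈ Fe, s.map f ∈ procSeq k Fe H0 i ∨ s.map f = x) (hs : ∃ s ∈ Fe, s.map f = x) :
    x ∈ procSeq k Fe H0 (i + 1) :=
  Or.inr ⟨hx, f, hf, hs⟩

/-- The combinatorial heart: a copy of `F - e₀` among the chosen edges yields a bad pair. -/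
lemma heart (hFe : ∀ s ∈ Fe, s.card = k) (e₀ : Finset ι)
    (he₀ : e₀ ∈ Fe) (hfin : Fe.Finite)
    (hne : (Fe \ {e₀}).Nonempty) (τ : ℕ) (e : ℕ → Finset V)
    (he : ∀ i < τ, e i ∈ procSeq k Fe H0 (i + 1) ∧ e i ∉ procSeq k Fe H0 i)
    (f : ι ↪ V) (S : Finset V)
    (hf : ∀ s ∈ Fe \ {e₀}, ∃ i, 1 ≤ i ∧ i < τ ∧ s.map f = e i ∧ e i ⊆ S)
    (he₀S : e₀.map f ⊆ S) :
    ∃ x i, 1 ≤ i ∧ i < τ ∧ x.card = k ∧ x ∈ procSeq k Fe H0 (i + 2) ∧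
      x ∉ procSeq k Fe H0 (i - 1) ∧ x ≠ e i ∧ x ⊆ S ∧ e i ⊆ S := by
  have hmono := proc_mono k Fe H0
  choose! a ha1 haτ hae haS using hf
  obtain ⟨s1, hs1, hmax⟩ := Set.exists_max_image (Fe \ {e₀}) a (hfin.subset Set.sdiff_subset) hne
  have hxk : (e₀.map f).card = k := by simp [hFe e₀ he₀]
  have hx2 : e₀.map f ∈ procSeq k Fe H0 (a s1 + 2) := by
    refine proc_add k Fe H0 (a s1 + 1) _ hxk f ?_ ⟨e₀, he₀, rfl⟩
    intro s hs
    by_cases hse : s = e₀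
    · right; rw [hse]
    · left
      have hs' : s ∈ Fe \ {e₀} := ⟨hs, hse⟩
      rw [hae s hs']
      exact hmono (Nat.succ_le_succ (hmax s hs')) (he _ (haτ s hs')).1
  have hinj : ∀ s t : Finset ι, s.map f = t.map f → s = t := fun s t h =>
    Finset.map_injective f h
  by_cases hx1 : e₀.map f ∈ procSeq k Fe H0 (a s1 - 1)
  swap
  · refine ⟨e₀.map f, a s1, ha1 s1 hs1, haτ s1 hs1, hxk, hx2, hx1, ?_, he₀S, haS s1 hs1⟩
    rw [← hae s1 hs1]
    intro h
    exact hs1.2 (hinj _ _ h).symm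
  by_cases hj : ∃ s ∈ Fe \ {e₀}, a s + 1 = a s1
  · obtain ⟨s, hs, hsa⟩ := hj
    have hes := he _ (haτ s hs)
    refine ⟨e (a s), a s1, ha1 s1 hs1, haτ s1 hs1, ?_, ?_, ?_, ?_, haS s hs, haS s1 hs1⟩
    · rw [← hae s hs]; simp [hFe s hs.1]
    · exact hmono (by omega) hes.1
    · rw [← hsa]; exact hes.2
    · rw [← hae s hs, ← hae s1 hs1]
      intro h
      have := hinj _ _ h
      subst this
      omega
  · exfalso
    push Not at hj
    have hcon : e (a s1) ∈ procSeq k Fe H0 ((a s1 - 1) + 1) := by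
      refine proc_add k Fe H0 _ _ ?_ f ?_ ⟨s1, hs1.1, hae s1 hs1⟩
      · rw [← hae s1 hs1]; simp [hFe s1 hs1.1]
      · intro s hs
        by_cases hse : s = e₀
        · left; rw [hse]; exact hx1
        · have hs' : s ∈ Fe \ {e₀} := ⟨hs, hse⟩
          by_cases hsa : a s = a s1
          · right; rw [hae s hs', hsa]
          · left
            rw [hae s hs']
            have h1 := hmax s hs'
            have h2 := hj s hs'
            exact hmono (by omega) (he _ (haτ s hs')).1
    have := ha1 s1 hs1
    rw [Nat.sub_add_cancel this] at hcon
    exact (he _ (haτ s1 hs1)).2 hcon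

lemma trivial_case (e₀ : Finset ι) (he₀ : e₀ ∈ Fe) (hemp : Fe \ {e₀} = ∅) :
    runTime k Fe H0 ≤ 1 := by
  apply Nat.sInf_le
  have hall : ∀ s ∈ Fe, s = e₀ := by
    intro s hs
    by_contra h
    have : s ∈ Fe \ {e₀} := ⟨hs, h⟩
    rw [hemp] at this
    exact this
  refine Set.Subset.antisymm (proc_mono k Fe H0 (by omega)) ?_
  rintro x (h | ⟨hx, f, -, s, hs, hsx⟩)
  · exact h
  · refine proc_add k Fe H0 0 x hx f ?_ ⟨s, hs, hsx⟩
    intro t ht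
    right
    rw [hall t ht, ← hall s hs, hsx]

end proc

lemma choose_ge (d k : ℕ) (hk : 1 ≤ k) : d ≤ (d + k).choose k := by
  induction k, hk using Nat.le_induction with
  | base => simp
  | succ k _ ih =>
    rw [← Nat.add_assoc, Nat.choose_succ_succ]
    omega

lemma runTime_bound {ι : Type*} [Finite ι] (k m n : ℕ) (hkm : k + 1 ≤ m)
    (Fe : Set (Finset ι)) (hFe : ∀ s ∈ Fe, s.card = k) (e₀ : Finset ι) (he₀ : e₀ ∈ Fe)
    (hne : (Fe \ {e₀}).Nonempty)
    (H0 : Set (Finset (Fin n))) (h0 : ∀ e ∈ H0, e.card = k) :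
    (runTime k Fe H0 - 1) * (n - k).choose (m - k) ≤
      n.choose m * exNum k (Fe \ {e₀}) m +
        m.choose k * (3 * n.choose k * (n - (k + 1)).choose (m - (k + 1))) := by
  classical
  set τ := runTime k Fe H0 with hτ
  have hmono := proc_mono k Fe H0
  have hex : ∀ i, i < τ → ∃ x, x ∈ procSeq k Fe H0 (i + 1) ∧ x ∉ procSeq k Fe H0 i := by
    intro i hi
    by_contra hcon
    push Not at hcon
    exact Nat.notMem_of_lt_sInf hi (Set.Subset.antisymm (hmono (Nat.le_succ i)) hcon)
  choose! e he using hex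
  have hinj : ∀ i j, i < j → j < τ → e i ≠ e j := by
    intro i j hij hj h
    apply (he j hj).2
    rw [← h]
    exact hmono hij (he i (hij.trans hj)).1
  let G : Finset (Finset (Fin n)) := (Finset.Ico 1 τ).image e
  have hGc : G.card = τ - 1 := by
    rw [Finset.card_image_of_injOn, Nat.card_Ico]
    intro i hi j hj h
    rw [Finset.mem_coe, Finset.mem_Ico] at hi hj
    rcases lt_trichotomy i j with hl | hl | hl
    · exact absurd h (hinj i j hl hj.2)
    · exact hl
    · exact absurd h.symm (hinj j i hl hi.2)
  have hek : ∀ i < τ, (e i).card = k := fun i hi => proc_card k Fe H0 h0 _ _ (he i hi).1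
  have hGk : ∀ g ∈ G, g.card = k := by
    intro g hg
    obtain ⟨i, hi, rfl⟩ := Finset.mem_image.1 hg
    exact hek i (Finset.mem_Ico.1 hi).2
  let P : Finset (Finset (Fin n) × ℕ) :=
    (powersetCard k (univ : Finset (Fin n)) ×ˢ Finset.Ico 1 τ).filter
      (fun p => p.1 ∈ procSeq k Fe H0 (p.2 + 2) ∧ p.1 ∉ procSeq k Fe H0 (p.2 - 1) ∧ p.1 ≠ e p.2)
  have hPmem : ∀ p, p ∈ P ↔ (p.1.card = k ∧ 1 ≤ p.2 ∧ p.2 < τ) ∧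
      p.1 ∈ procSeq k Fe H0 (p.2 + 2) ∧ p.1 ∉ procSeq k Fe H0 (p.2 - 1) ∧ p.1 ≠ e p.2 := by
    intro p
    simp only [P, Finset.mem_filter, Finset.mem_product, mem_powersetCard, Finset.mem_Ico,
      Finset.subset_univ, true_and]
  have hPc : P.card ≤ 3 * n.choose k := by
    have hmaps : ∀ p ∈ P, p.1 ∈ powersetCard k (univ : Finset (Fin n)) := by
      intro p hp
      exact mem_powersetCard.2 ⟨Finset.subset_univ _, ((hPmem p).1 hp).1.1⟩
    have := Finset.card_le_mul_card_image_of_maps_to (f := Prod.fst) hmaps 3 (by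
      intro x _
      let t := sInf {t | x ∈ procSeq k Fe H0 t}
      have hsub : P.filter (fun p => p.1 = x) ⊆ (Finset.Icc (t - 2) t).image (fun i => (x, i)) := by
        rintro ⟨y, i⟩ hp
        obtain ⟨hp, hyx⟩ := Finset.mem_filter.1 hp
        obtain ⟨⟨-, h1, -⟩, h2, h3, -⟩ := (hPmem _).1 hp
        dsimp only at hyx h1 h2 h3
        subst hyx
        refine Finset.mem_image.2 ⟨i, ?_, rfl⟩
        have hta : t ≤ i + 2 := Nat.sInf_le h2
        have htm : y ∈ procSeq k Fe H0 t := Nat.sInf_mem (s := {t | y ∈ procSeq k Fe H0 t})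
          ⟨i + 2, h2⟩
        have htb : i - 1 < t := by
          by_contra hcon
          exact h3 (hmono (not_lt.1 hcon) htm)
        rw [Finset.mem_Icc]
        omega
      refine (Finset.card_le_card hsub).trans (Finset.card_image_le.trans ?_)
      rw [Nat.card_Icc]
      omega)
    simpa using this
  have hcore := core k m n (by omega) (Fe \ {e₀}) G hGk P (fun p => p.1 ∪ e p.2) (by
    rintro S hS ⟨f, hfS, hf⟩
    have hmapS : ∀ s : Finset ι, s.map f ⊆ S := by
      intro s x hx
      obtain ⟨i, -, rfl⟩ := Finset.mem_map.1 hx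
      exact hfS i
    obtain ⟨x, i, h1, h2, h3, h4, h5, h6, h7, h8⟩ :=
      heart k Fe H0 hFe e₀ he₀ (Set.toFinite _) hne τ e he f S (by
        intro s hs
        obtain ⟨i, hi, his⟩ := Finset.mem_image.1 (hf s hs)
        rw [Finset.mem_Ico] at hi
        exact ⟨i, hi.1, hi.2, his.symm, his ▸ hmapS s⟩) (hmapS e₀)
    exact hS (x, i) ((hPmem _).2 ⟨⟨h3, h1, h2⟩, h4, h5, h6⟩) (Finset.union_subset h7 h8))
  rw [hGc] at hcore
  refine hcore.trans (Nat.add_le_add_left (Nat.mul_le_mul_left _ ?_) _)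
  refine (Finset.sum_le_card_nsmul P _ ((n - (k + 1)).choose (m - (k + 1))) ?_).trans ?_
  · intro p hp
    obtain ⟨⟨h1, h2, h3⟩, -, -, h6⟩ := (hPmem p).1 hp
    have hcard : k + 1 ≤ (p.1 ∪ e p.2).card := by
      by_contra hcon
      have hle : (p.1 ∪ e p.2).card ≤ k := by omega
      have ha := Finset.eq_of_subset_of_card_le
        (Finset.subset_union_left (s₁ := p.1) (s₂ := e p.2)) (by rw [h1]; exact hle)
      have hb := Finset.eq_of_subset_of_card_le
        (Finset.subset_union_right (s₁ := p.1) (s₂ := e p.2)) (by rw [hek _ h3]; exact hle)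
      exact h6 (ha.trans hb.symm)
    obtain ⟨c, hc, hcc⟩ := Finset.exists_subset_card_eq hcard
    have hcount := card_filter_powersetCard_subset c (univ : Finset (Fin n)) m
      (Finset.subset_univ _) (by omega)
    rw [hcc, Finset.card_univ, Fintype.card_fin] at hcount
    rw [← hcount]
    apply Finset.card_le_card
    intro S hS
    rw [Finset.mem_filter] at hS ⊢
    exact ⟨hS.1, hc.trans hS.2⟩
  · rw [smul_eq_mul]
    exact Nat.mul_le_mul_right _ hPc

lemma runTime_ratio {ι : Type*} [Finite ι] (k m n : ℕ) (hkm : k + 1 ≤ m) (hmn : m ≤ n)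
    (hk : 1 ≤ k)
    (Fe : Set (Finset ι)) (hFe : ∀ s ∈ Fe, s.card = k) (e₀ : Finset ι) (he₀ : e₀ ∈ Fe)
    (H0 : Set (Finset (Fin n))) (h0 : ∀ e ∈ H0, e.card = k) :
    (runTime k Fe H0 : ℝ) ≤ ((exNum k (Fe \ {e₀}) m : ℝ) / (m.choose k : ℝ) +
      (3 * m.choose k * m + 1 : ℝ) / ((n - k : ℕ) : ℝ)) * (n.choose k : ℝ) := by
  have p1 : 0 < n.choose k := Nat.choose_pos (by omega)
  have p2 : 0 < m.choose k := Nat.choose_pos (by omega)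
  have p3 : 0 < (n - k).choose (m - k) := Nat.choose_pos (by omega)
  have hd : (n - k : ℕ) ≤ n.choose k := by
    have := choose_ge (n - k) k hk
    rwa [Nat.sub_add_cancel (by omega)] at this
  have hd0 : 0 < n - k := by omega
  have q1 : (0 : ℝ) < n.choose k := by exact_mod_cast p1
  have q2 : (0 : ℝ) < m.choose k := by exact_mod_cast p2
  have q3 : (0 : ℝ) < (n - k).choose (m - k) := by exact_mod_cast p3
  have q4 : (0 : ℝ) < (n - k : ℕ) := by exact_mod_cast hd0
  have hone : (1 : ℝ) ≤ 1 / ((n - k : ℕ) : ℝ) * n.choose k := by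
    rw [one_div, inv_mul_eq_div, le_div_iff₀ q4, one_mul]
    exact_mod_cast hd
  have hsplit : ((exNum k (Fe \ {e₀}) m : ℝ) / (m.choose k : ℝ) +
      (3 * m.choose k * m + 1 : ℝ) / ((n - k : ℕ) : ℝ)) * (n.choose k : ℝ) =
      ((exNum k (Fe \ {e₀}) m : ℝ) / (m.choose k : ℝ) * n.choose k +
      (3 * m.choose k * m : ℝ) / ((n - k : ℕ) : ℝ) * n.choose k) +
      1 / ((n - k : ℕ) : ℝ) * n.choose k := by ring
  rw [hsplit]
  rcases Set.eq_empty_or_nonempty (Fe \ {e₀}) with hemp | hne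
  · have h1 : (runTime k Fe H0 : ℝ) ≤ 1 := by
      exact_mod_cast trivial_case k Fe H0 e₀ he₀ hemp
    have : (0 : ℝ) ≤ (exNum k (Fe \ {e₀}) m : ℝ) / (m.choose k : ℝ) * n.choose k +
      (3 * m.choose k * m : ℝ) / ((n - k : ℕ) : ℝ) * n.choose k := by positivity
    linarith
  · have hb := runTime_bound k m n hkm Fe hFe e₀ he₀ hne H0 h0
    have hcm := Nat.choose_mul (n := n) (k := m) (s := k) (by omega)
    have hs : (n - k) * (n - (k + 1)).choose (m - (k + 1)) ≤ (n - k).choose (m - k) * m := by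
      have := Nat.add_one_mul_choose_eq (n - (k + 1)) (m - (k + 1))
      rw [show n - (k + 1) + 1 = n - k by omega, show m - (k + 1) + 1 = m - k by omega] at this
      rw [this]
      exact Nat.mul_le_mul_left _ (Nat.sub_le _ _)
    have hsub : (runTime k Fe H0 : ℝ) - 1 ≤ ((runTime k Fe H0 - 1 : ℕ) : ℝ) := by
      have : runTime k Fe H0 ≤ (runTime k Fe H0 - 1) + 1 := by omega
      have : (runTime k Fe H0 : ℝ) ≤ ((runTime k Fe H0 - 1 : ℕ) : ℝ) + 1 := by exact_mod_cast this
      linarith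
    have hbR : ((runTime k Fe H0 - 1 : ℕ) : ℝ) * (n - k).choose (m - k) ≤
      n.choose m * exNum k (Fe \ {e₀}) m +
        m.choose k * (3 * n.choose k * (n - (k + 1)).choose (m - (k + 1))) := by
      exact_mod_cast hb
    have hcmR : (n.choose m : ℝ) * m.choose k = n.choose k * (n - k).choose (m - k) := by
      exact_mod_cast hcm
    have hsR : ((n - k : ℕ) : ℝ) * (n - (k + 1)).choose (m - (k + 1)) ≤
        (n - k).choose (m - k) * m := by exact_mod_cast hs
    have hnm : (n.choose m : ℝ) = n.choose k * (n - k).choose (m - k) / m.choose k := by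
      rw [eq_div_iff q2.ne', hcmR]
    have hlast : ((n - (k + 1)).choose (m - (k + 1)) : ℝ) ≤
        (n - k).choose (m - k) * m / ((n - k : ℕ) : ℝ) := by
      rw [le_div_iff₀ q4]; linarith
    have hfin : ((runTime k Fe H0 - 1 : ℕ) : ℝ) ≤
        (exNum k (Fe \ {e₀}) m : ℝ) / (m.choose k : ℝ) * n.choose k +
        (3 * m.choose k * m : ℝ) / ((n - k : ℕ) : ℝ) * n.choose k := by
      refine le_of_mul_le_mul_right (hbR.trans ?_) q3
      calc (n.choose m : ℝ) * exNum k (Fe \ {e₀}) m +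
            m.choose k * (3 * n.choose k * (n - (k + 1)).choose (m - (k + 1)))
          ≤ n.choose k * (n - k).choose (m - k) / m.choose k * exNum k (Fe \ {e₀}) m +
            m.choose k * (3 * n.choose k *
              ((n - k).choose (m - k) * m / ((n - k : ℕ) : ℝ))) := by
            rw [hnm]; gcongr
        _ = _ := by ring
    linarith

end BootAux

/-- For every `k ≥ 2`, every `k`-graph `F`, every edge `e₀ ∈ E(F)`, and every `ε > 0`,
for all sufficiently large `n`, `M_F(n) ≤ (π(F − e₀) + ε) · C(n,k)`. -/
theorem maxRunTime_le_turanDensity_minus_edge (k : ℕ) (hk : 2 ≤ k) {ι : Type*} [Fintype ι]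
    (Fe : Set (Finset ι)) (hFe : ∀ s ∈ Fe, s.card = k) (e₀ : Finset ι) (he₀ : e₀ ∈ Fe)
    (ε : ℝ) (hε : 0 < ε) :
    ∃ n₀ : ℕ, ∀ n : ℕ, n₀ ≤ n →
      (maxRunTime k Fe n : ℝ) ≤ (turanDensity k (Fe \ {e₀}) + ε) * (n.choose k : ℝ) := by
  obtain ⟨m, hm, hlt⟩ := BootAux.exists_m k (Fe \ {e₀}) (ε / 2) (by linarith)
  obtain ⟨N, hN⟩ := exists_nat_gt ((3 * m.choose k * m + 1 : ℝ) / (ε / 2))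
  refine ⟨N + m + k, fun n hn => ?_⟩
  have hall : ∀ H0 : Set (Finset (Fin n)), (∀ e ∈ H0, e.card = k) →
      (runTime k Fe H0 : ℝ) ≤ (turanDensity k (Fe \ {e₀}) + ε) * (n.choose k : ℝ) := by
    intro H0 h0
    refine (BootAux.runTime_ratio k m n hm (by omega) (by omega) Fe hFe e₀ he₀ H0 h0).trans ?_
    have h1 : (3 * m.choose k * m + 1 : ℝ) / ((n - k : ℕ) : ℝ) ≤ ε / 2 := by
      have h2 : (N : ℝ) ≤ ((n - k : ℕ) : ℝ) := by
        exact_mod_cast (show N ≤ n - k by omega)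
      have h3 : (0 : ℝ) < ((n - k : ℕ) : ℝ) := by
        exact_mod_cast (show 0 < n - k by omega)
      rw [div_lt_iff₀ (by linarith)] at hN
      rw [div_le_iff₀ h3]
      nlinarith
    apply mul_le_mul_of_nonneg_right _ (Nat.cast_nonneg _)
    linarith
  have hnonneg : 0 ≤ (turanDensity k (Fe \ {e₀}) + ε) * (n.choose k : ℝ) :=
    (Nat.cast_nonneg _).trans (hall ∅ (by simp))
  have hfl : maxRunTime k Fe n ≤
      ⌊(turanDensity k (Fe \ {e₀}) + ε) * (n.choose k : ℝ)⌋₊ := by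
    apply csSup_le'
    rintro _ ⟨H0, h0, rfl⟩
    exact Nat.le_floor (hall H0 h0)
  exact (Nat.cast_le.2 hfl).trans (Nat.floor_le hnonneg)
end

section
/- Erdős–Stone–Simonovits: for every graph F with at least one edge, the Turán density satisfies π(F) = (χ(F) − 2)/(χ(F) − 1), where χ(F) is the chromatic number; i.e., ex(n,F) = ((χ(F)−2)/(χ(F)−1) + o(1))·C(n,2). -/
open Finset Filter

section ESSHelpers

open SimpleGraph

lemma gContains_iff_isContained {α β : Type*} (F : SimpleGraph α) (H : SimpleGraph β) :
    GContains F H ↔ F.IsContained H := by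
  constructor
  · rintro ⟨f, hf⟩
    exact ⟨⟨⟨f, fun {a b} h => hf a b h⟩, f.injective⟩⟩
  · rintro ⟨c⟩
    exact ⟨⟨c, c.injective⟩, fun a b h => c.toHom.map_adj h⟩

lemma gExNum_eq_extremalNumber {α : Type*} (F : SimpleGraph α) (hF : F ≠ ⊥) (n : ℕ) :
    gExNum F n = extremalNumber n F := by
  classical
  have hle : ∀ m ∈ {m | ∃ H : SimpleGraph (Fin n), ¬ GContains F H ∧ m = H.edgeSet.ncard},
      m ≤ extremalNumber n F := by
    rintro m ⟨H, hH, rfl⟩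
    rw [gContains_iff_isContained] at hH
    have h := card_edgeFinset_le_extremalNumber (G := H) (H := F) hH
    rw [Fintype.card_fin] at h
    rwa [← coe_edgeFinset, Set.ncard_coe_finset]
  apply le_antisymm
  · refine csSup_le ?_ hle
    refine ⟨_, ⊥, ?_, rfl⟩
    rw [gContains_iff_isContained]
    exact free_bot hF
  · obtain ⟨G, hd, hG⟩ := exists_isExtremal_free (V := Fin n) hF
    refine le_csSup ⟨_, hle⟩ ⟨G, ?_, ?_⟩
    · rw [gContains_iff_isContained]
      exact hG.1
    · have h := card_edgeFinset_of_isExtremal_free hG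
      rw [Fintype.card_fin] at h
      rw [← coe_edgeFinset, Set.ncard_coe_finset, h]

lemma le_turanDensity_of_not_colorable {α : Type*} (F : SimpleGraph α) {r : ℕ} (hr : 0 < r)
    (hc : ¬ F.Colorable r) : 1 - 1 / (r : ℝ) ≤ turanDensity F := by
  classical
  have ht : Tendsto (fun t : ℕ => r * (t + 2)) atTop atTop :=
    tendsto_atTop_mono (fun t => by simp only [id]; nlinarith) tendsto_id
  refine ge_of_tendsto' ((tendsto_turanDensity F).comp ht) fun t => ?_
  have hfree : F.Free (completeEquipartiteGraph r (t + 2)) := by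
    rintro ⟨c⟩
    exact hc ⟨Coloring.mk (fun v => (c v).1) fun {a b} h => c.toHom.map_adj h⟩
  have h := card_edgeFinset_le_extremalNumber hfree
  rw [card_edgeFinset_completeEquipartiteGraph, Fintype.card_prod, Fintype.card_fin,
    Fintype.card_fin] at h
  have h' : ((r.choose 2 * (t + 2) ^ 2 : ℕ) : ℝ) ≤ extremalNumber (r * (t + 2)) F :=
    Nat.cast_le.mpr h
  have hr1 : (1 : ℝ) ≤ r := by exact_mod_cast hr
  have ht0 : (0 : ℝ) ≤ t := by positivity
  have hpos : (0 : ℝ) < r * (t + 2) - 1 := by nlinarith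
  simp only [Function.comp_apply]
  rw [le_div_iff₀ (by rw [Nat.cast_choose_two]; push_cast; positivity)]
  refine le_trans ?_ h'
  push_cast [Nat.cast_choose_two]
  have : (1 - 1 / (r : ℝ)) * (r * (t + 2) * (r * (t + 2) - 1) / 2)
      = (r - 1) * (t + 2) * (r * (t + 2) - 1) / 2 := by
    field_simp
  rw [this]
  nlinarith [mul_nonneg (sub_nonneg.mpr hr1) (by positivity : (0 : ℝ) ≤ t + 2)]

lemma turanDensity_le_of_colorable {α : Type*} [Fintype α] (F : SimpleGraph α) {r : ℕ}
    (hr : 0 < r) (hc : F.Colorable (r + 1)) : turanDensity F ≤ 1 - 1 / (r : ℝ) := by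
  classical
  refine le_of_forall_pos_le_add fun ε hε => ?_
  have hr1 : (1 : ℝ) ≤ r := by exact_mod_cast hr
  have hc0 : 0 < 1 - 1 / (r : ℝ) + ε := by
    have : 1 / (r : ℝ) ≤ 1 := by rw [div_le_one (by linarith)]; exact hr1
    linarith
  obtain ⟨C⟩ := hc
  have hcont : F.IsContained (completeEquipartiteGraph (r + 1) (Fintype.card α)) :=
    isContained_completeEquipartiteGraph_of_colorable C _ fun c => Fintype.card_subtype_le _
  obtain ⟨N, hN⟩ := eventually_atTop.mp
    (eventually_completeEquipartiteGraph_isContained_of_minDegree hε r (Fintype.card α))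
  set c : ℝ := 1 - 1 / (r : ℝ) + ε with hcdef
  have step : ∀ n ≥ N, (extremalNumber (n + 1) F : ℝ) ≤ extremalNumber n F + c * (n + 1) := by
    intro n hn
    have key : (extremalNumber (Fintype.card (Fin (n + 1))) F : ℝ)
        ≤ extremalNumber n F + c * (n + 1) := by
      rw [extremalNumber_le_iff_of_nonneg F (by positivity)]
      intro G _ hG
      have hdeg : (G.minDegree : ℝ) < c * ((n + 1 : ℕ) : ℝ) := by
        by_contra! hcon
        exact hG (hcont.trans (hN (n + 1) (by omega) hcon))
      obtain ⟨v, hv⟩ := G.exists_minimal_degree_vertex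
      have h1 := card_edgeFinset_deleteIncidenceSet_le_extremalNumber hG v
      have h2 := G.card_edgeFinset_deleteIncidenceSet v
      rw [Fintype.card_fin, Nat.add_sub_cancel] at h1
      rw [hv] at hdeg
      have h3 : G.edgeFinset.card ≤ extremalNumber n F + G.degree v := by omega
      have h4 : (G.edgeFinset.card : ℝ) ≤ extremalNumber n F + G.degree v := by exact_mod_cast h3
      push_cast at hdeg
      linarith
    rwa [Fintype.card_fin] at key
  have bound : ∀ n ≥ N, (extremalNumber n F : ℝ) ≤ extremalNumber N F + c * (n * (n + 1) / 2) := by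
    intro n hn
    induction n, hn using Nat.le_induction with
    | base => have : 0 ≤ c * ((N : ℝ) * (N + 1) / 2) := by positivity
              linarith
    | succ n hn ih =>
      have := step n hn
      push_cast
      linarith
  by_contra! hlt
  set A : ℝ := (extremalNumber N F : ℝ) with hA
  obtain ⟨m, hm⟩ := exists_nat_gt ((turanDensity F + c + 2 * A + 1) / (turanDensity F - c))
  set n : ℕ := max (max m N) 2 with hn
  have hn2 : 2 ≤ n := le_max_right _ _
  have hnN : N ≤ n := (le_max_right _ _).trans (le_max_left _ _)
  have hnm : (m : ℝ) ≤ n := by exact_mod_cast (le_max_left _ _).trans (le_max_left _ _)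
  have hlow : turanDensity F ≤ extremalNumber n F / (n.choose 2 : ℝ) :=
    (isGLB_turanDensity F).1 ⟨n, hn2, rfl⟩
  have hn2' : (2 : ℝ) ≤ n := by exact_mod_cast hn2
  rw [le_div_iff₀ (by exact_mod_cast Nat.choose_pos hn2), Nat.cast_choose_two] at hlow
  have hup := bound n hnN
  have hA0 : 0 ≤ A := by positivity
  have hbig := (div_lt_iff₀ (sub_pos.mpr hlt)).mp (hm.trans_le hnm)
  nlinarith [mul_pos (by linarith : (0 : ℝ) < n) (sub_pos.mpr hbig)]

end ESSHelpers

/-- Erdős–Stone–Simonovits: for every graph `F` with at least one edge,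
`ex(n,F)/C(n,2)` tends to `(χ(F) − 2)/(χ(F) − 1)`. -/
theorem erdos_stone_simonovits {α : Type*} [Fintype α] (F : SimpleGraph α)
    (hF : F.edgeSet.Nonempty) :
    Tendsto (fun n : ℕ => (gExNum F n : ℝ) / (n.choose 2 : ℝ)) atTop
      (nhds (((F.chromaticNumber.toNat : ℝ) - 2) / ((F.chromaticNumber.toNat : ℝ) - 1))) := by
  have hne : F ≠ ⊥ := SimpleGraph.edgeSet_nonempty.mp hF
  have hcol : F.Colorable F.chromaticNumber.toNat := by
    apply SimpleGraph.chromaticNumber_le_iff_colorable.mp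
    rw [ENat.natCast_toNat]
    exact SimpleGraph.chromaticNumber_ne_top_iff_exists.mpr ⟨_, F.colorable_of_fintype⟩
  obtain ⟨k, hk⟩ : ∃ k, F.chromaticNumber.toNat = k := ⟨_, rfl⟩
  have htop : F.chromaticNumber = (k : ℕ∞) := by
    rw [← hk, ENat.natCast_toNat]
    exact SimpleGraph.chromaticNumber_ne_top_iff_exists.mpr ⟨_, F.colorable_of_fintype⟩
  have hk2 : 2 ≤ k := by
    have := SimpleGraph.two_le_chromaticNumber_iff_ne_bot.mpr hne
    rw [htop] at this
    exact_mod_cast this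
  rw [hk] at hcol ⊢
  obtain ⟨r, rfl⟩ : ∃ r, k = r + 1 := ⟨k - 1, by omega⟩
  have hr : 0 < r := by omega
  have hnc : ¬ F.Colorable r := by
    intro h
    have := h.chromaticNumber_le
    rw [htop] at this
    have h' : r + 1 ≤ r := by exact_mod_cast this
    omega
  have hπ : SimpleGraph.turanDensity F = (((r + 1 : ℕ) : ℝ) - 2) / (((r + 1 : ℕ) : ℝ) - 1) := by
    rw [le_antisymm (turanDensity_le_of_colorable F hr hcol)
      (le_turanDensity_of_not_colorable F hr hnc)]
    have : (r : ℝ) ≠ 0 := by positivity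
    push_cast
    rw [add_sub_cancel_right]
    field_simp
    ring
  rw [← hπ]
  simp_rw [gExNum_eq_extremalNumber F hne]
  exact SimpleGraph.tendsto_turanDensity F
end
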